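/- Let G be a discrete group acting by *-automorphisms σ on a unital C*-algebra A and continuously on a compact Hausdorff space Y. Let S(A) denote the state space of A with the weak* topology and the G-action (s·τ)(a) = τ(σ_{s⁻¹}(a)). Let Q be a G-invariant closed *-subalgebra with C(Y) ⊆ Q ⊆ C(Y,A) (diagonal G-action, C(Y) embedded as y ↦ g(y)·1_A). Assume that every intermediate G-factor between Y × S(A) and Y is a product: for every closed G-invariant equivalence relation ~ on Y × S(A) (G acting diagonally) satisfying (y,τ) ~ (y',τ') ⟹ y = y', there exists a closed G-invariant equivalence relation ≈ on S(A) such that (y,τ) ~ (y',τ') ⟺ (y = y' and τ ≈ τ'). Then Q is a tensor product: there is a G-invariant closed *-subalgebra 𝓑 ⊆ A with Q = {f ∈ C(Y,A) : f(y) ∈ 𝓑 for all y ∈ Y}. -/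

import Mathlib

open MeasureTheory Filter Topology
open scoped ComplexOrder

noncomputable def embedScalar {Y : Type*} (A : Type*) [TopologicalSpace Y] [CStarAlgebra A]
    (g : C(Y, ℂ)) : C(Y, A) :=
  ⟨fun y => g y • (1 : A), g.continuous.smul continuous_const⟩

theorem MonoidHom.starAlgHom_leftInv {G A : Type*} [Group G] [CStarAlgebra A]
    (σ : G →* (A →⋆ₐ[ℂ] A)) (g : G) (a : A) : σ g⁻¹ (σ g a) = a := by
  have h : σ g⁻¹ * σ g = 1 := by rw [← map_mul, inv_mul_cancel, map_one]
  calc σ g⁻¹ (σ g a) = (σ g⁻¹ * σ g) a := rfl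
    _ = a := by rw [h]; rfl

theorem MonoidHom.starAlgHom_continuous {G A : Type*} [Group G] [CStarAlgebra A]
    (σ : G →* (A →⋆ₐ[ℂ] A)) (g : G) : Continuous (σ g) :=
  (NonUnitalStarAlgHom.isometry (σ g)
    (Function.LeftInverse.injective (MonoidHom.starAlgHom_leftInv σ g))).continuous

/-- The diagonal action of `G` on `C(Y,A)`: `(s • f) y = σ_s (f (s⁻¹ • y))`. -/
noncomputable def diagAct {G Y A : Type*} [Group G] [TopologicalSpace Y]
    [MulAction G Y] [CStarAlgebra A] (hc : ∀ s : G, Continuous fun y : Y => s • y)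
    (σ : G →* (A →⋆ₐ[ℂ] A)) (s : G) (f : C(Y, A)) : C(Y, A) :=
  ⟨fun y => σ s (f (s⁻¹ • y)),
    (MonoidHom.starAlgHom_continuous σ s).comp (f.continuous.comp (hc s⁻¹))⟩

/-- A *-algebra endomorphism of a C*-algebra, as a continuous linear map. -/
noncomputable def sigmaCLM {G A : Type*} [Group G] [CStarAlgebra A]
    (σ : G →* (A →⋆ₐ[ℂ] A)) (g : G) : A →L[ℂ] A where
  toFun := σ g
  map_add' := map_add (σ g)
  map_smul' := map_smul (σ g)
  cont := MonoidHom.starAlgHom_continuous σ g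

/-- The state space of a unital C*-algebra `A`: the set of continuous linear
functionals `τ` with `τ 1 = 1` and `τ (a* a) ≥ 0`, carrying the weak* topology. -/
abbrev StateSpace (A : Type*) [CStarAlgebra A] : Type _ :=
  {φ : WeakDual ℂ A // φ 1 = 1 ∧ ∀ a : A, 0 ≤ φ (star a * a)}

/-- The `G`-action on the state space of `A`, `(s • τ) a = τ (σ_{s⁻¹} a)`. -/
noncomputable def stateAct {G A : Type*} [Group G] [CStarAlgebra A]
    (σ : G →* (A →⋆ₐ[ℂ] A)) (s : G) (τ : StateSpace A) : StateSpace A :=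
  ⟨ContinuousLinearMap.comp (τ.1 : A →L[ℂ] ℂ) (sigmaCLM σ s⁻¹), by
    constructor
    · show τ.1 (σ s⁻¹ 1) = 1
      rw [map_one]; exact τ.2.1
    · intro a
      show 0 ≤ τ.1 (σ s⁻¹ (star a * a))
      rw [map_mul, map_star]
      exact τ.2.2 _⟩

section Helpers
variable {A : Type*} [CStarAlgebra A]

/-- positivity -/
def PosF (φ : A →L[ℂ] ℂ) : Prop := ∀ a : A, 0 ≤ φ (star a * a)

theorem PosF.selfAdj {φ : A →L[ℂ] ℂ} (h : PosF φ) {a : A} (ha : IsSelfAdjoint a) :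
    (φ a).im = 0 ∧ |(φ a).re| ≤ ‖a‖ * (φ 1).re := by
  let _ := CStarAlgebra.spectralOrder A
  let _ := CStarAlgebra.spectralOrderedRing A
  have hn : ∀ x : A, 0 ≤ x → 0 ≤ φ x := by
    intro x hx
    obtain ⟨b, rfl⟩ := CStarAlgebra.nonneg_iff_eq_star_mul_self.1 hx
    exact h b
  have h1 : 0 ≤ φ 1 := by simpa using h 1
  have e : ∀ r : ℝ, φ (algebraMap ℝ A r) = r * φ 1 := by
    intro r
    rw [Algebra.algebraMap_eq_smul_one, ← Complex.coe_smul, map_smul, smul_eq_mul]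
  have h2 := hn _ (sub_nonneg.2 ha.le_algebraMap_norm_self)
  have h3 := hn _ (sub_nonneg.2 ha.neg_algebraMap_norm_le_self)
  rw [map_sub, e] at h2
  rw [sub_neg_eq_add, map_add, e] at h3
  rw [Complex.nonneg_iff] at h1 h2 h3
  simp at h1 h2 h3
  refine ⟨?_, ?_⟩
  · simpa [← h1.2] using h3.2.symm
  · rw [abs_le]; constructor <;> linarith

theorem PosF.map_star {φ : A →L[ℂ] ℂ} (h : PosF φ) (a : A) :
    φ (star a) = star (φ a) := by
  have hr := (h.selfAdj (realPart a).2).1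
  have hi := (h.selfAdj (imaginaryPart a).2).1
  have e := realPart_add_I_smul_imaginaryPart a
  have e2 : star a = (realPart a : A) - Complex.I • (imaginaryPart a : A) := by
    conv_lhs => rw [← e]
    simp [sub_eq_add_neg]
  conv_rhs => rw [← e]
  rw [e2]
  apply Complex.ext <;> simp [hr, hi]

theorem PosF.bound {φ : A →L[ℂ] ℂ} (h : PosF φ) (a : A) :
    ‖φ a‖ ≤ 2 * ‖a‖ * (φ 1).re := by
  have key : ∀ x : selfAdjoint A, ‖x‖ ≤ ‖a‖ → ‖φ x‖ ≤ ‖a‖ * (φ 1).re := by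
    intro x hx
    have h1 : 0 ≤ φ 1 := by simpa using h 1
    have := h.selfAdj x.2
    have e : φ x = ((φ x).re : ℂ) := by apply Complex.ext <;> simp [this.1]
    rw [e, Complex.norm_real, Real.norm_eq_abs]
    refine this.2.trans ?_
    gcongr
    · exact (Complex.nonneg_iff.1 h1).1
    · exact hx
  have e := realPart_add_I_smul_imaginaryPart a
  calc ‖φ a‖ = ‖φ (realPart a : A) + Complex.I * φ (imaginaryPart a : A)‖ := by
        conv_lhs => rw [← e]
        simp
    _ ≤ ‖φ (realPart a : A)‖ + ‖φ (imaginaryPart a : A)‖ := by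
        refine (norm_add_le _ _).trans ?_
        simp
    _ ≤ _ := by
        have := key _ (realPart.norm_le a)
        have := key _ (imaginaryPart.norm_le a)
        linarith

theorem posF_of_norm {f : A →L[ℂ] ℂ} (hf : ‖f‖ ≤ 1) (h1 : f 1 = 1) : PosF f := by
  let _ := CStarAlgebra.spectralOrder A
  let _ := CStarAlgebra.spectralOrderedRing A
  have hb : ∀ x, ‖f x‖ ≤ ‖x‖ := fun x => by
    simpa using f.le_of_opNorm_le hf x
  have nt : Nontrivial A := by
    refine ⟨0, 1, fun h => ?_⟩
    rw [← h] at h1; simp at h1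
  have im0 : ∀ b : A, IsSelfAdjoint b → (f b).im = 0 := by
    intro b hb'
    have key : ∀ t : ℝ, ((f b).im + t)^2 ≤ ‖b‖^2 + t^2 := by
      intro t
      have e : f (b + (Complex.I * t) • (1:A)) = f b + Complex.I * t := by simp [h1]
      have n := hb (b + (Complex.I * t) • (1:A))
      have n2 : ‖b + (Complex.I * t) • (1:A)‖^2 ≤ ‖b‖^2 + t^2 := by
        rw [sq, ← CStarRing.norm_star_mul_self]
        have : star (b + (Complex.I * t) • (1:A)) * (b + (Complex.I * t) • (1:A))
            = star b * b + ((t^2 : ℝ) : ℂ) • (1 : A) := by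
          rw [star_add, hb'.star_eq, star_smul, star_one]
          simp only [add_mul, mul_add, smul_mul_assoc, mul_smul_comm, one_mul, mul_one]
          have i1 : star (Complex.I * (t:ℂ)) = - (Complex.I * t) := by simp
          rw [i1]
          have i2 : Complex.I * (t:ℂ) * -(Complex.I * t) = ((t^2 : ℝ) : ℂ) := by
            push_cast; linear_combination (- (t:ℂ)^2) * Complex.I_sq
          rw [smul_add, smul_smul, i2, neg_smul]; abel
        rw [this]
        refine (norm_add_le _ _).trans ?_
        rw [CStarRing.norm_star_mul_self, norm_smul, ← sq]
        simp
      rw [e] at n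
      have n3 : ((f b).im + t)^2 ≤ ‖f b + Complex.I * t‖^2 := by
        rw [← Complex.normSq_eq_norm_sq, Complex.normSq_apply]
        simp
        nlinarith [mul_self_nonneg (f b).re]
      have : ‖f b + Complex.I * t‖^2 ≤ ‖b + (Complex.I * t) • (1:A)‖^2 := by gcongr
      linarith
    by_contra hne
    have := key ((‖b‖^2 + 1) / (2 * (f b).im))
    have e : (f b).im * ((‖b‖^2 + 1) / (2 * (f b).im)) = (‖b‖^2 + 1)/2 := by field_simp
    nlinarith [sq_nonneg (f b).im]
  intro a
  set b := star a * a with hbdef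
  have hb0 : 0 ≤ b := star_mul_self_nonneg a
  have hbs : IsSelfAdjoint b := .of_nonneg hb0
  have n : ‖algebraMap ℝ A ‖b‖ - b‖ ≤ ‖b‖ := by
    rw [CStarAlgebra.norm_le_iff_le_algebraMap _ (norm_nonneg _)
      (sub_nonneg.2 hbs.le_algebraMap_norm_self)]
    simpa using hb0
  have e : f (algebraMap ℝ A ‖b‖ - b) = ‖b‖ - f b := by
    rw [map_sub, Algebra.algebraMap_eq_smul_one, ← Complex.coe_smul, map_smul, h1]; simp
  have := (Complex.re_le_norm _).trans ((hb _).trans n)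
  rw [e] at this
  simp at this
  rw [Complex.nonneg_iff]
  exact ⟨this, (im0 b hbs).symm⟩

theorem exists_state_aux [Nontrivial A] {a : A} (h : ‖a‖ ∈ spectrum ℝ a) :
    ∃ f : A →L[ℂ] ℂ, PosF f ∧ f 1 = 1 ∧ (f a).re = ‖a‖ := by
  have hx : 1 + ‖a‖ ≤ ‖(1:A) + a‖ := by
    have : (1 + ‖a‖ : ℝ) ∈ spectrum ℝ ((1:A) + a) := by
      have := spectrum.add_mem_add_iff (R := ℝ) (a := a) (r := ‖a‖) (s := 1)
      simp at this
      rw [add_comm (1:ℝ)]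
      exact this.2 h
    have := spectrum.norm_le_norm_of_mem this
    rwa [Real.norm_of_nonneg (by positivity)] at this
  obtain ⟨f, hf, hfx⟩ := exists_dual_vector'' ℂ ((1:A) + a)
  have hb : ∀ x, ‖f x‖ ≤ ‖x‖ := fun x => by
    simpa using f.le_of_opNorm_le hf x
  have e : (f 1).re + (f a).re = ‖(1:A) + a‖ := by
    have := congrArg Complex.re hfx
    simpa using this
  have n1 := hb 1
  rw [norm_one] at n1
  have r1 := (Complex.re_le_norm _).trans n1
  have ra := (Complex.re_le_norm _).trans (hb a)
  have e1 : (f 1).re = 1 := by linarith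
  have e2 : (f a).re = ‖a‖ := by linarith
  have e3 : f 1 = 1 := by
    have := Complex.normSq_eq_norm_sq (f 1)
    rw [Complex.normSq_apply, e1] at this
    have : (f 1).im = 0 := by
      have : ‖f 1‖^2 ≤ 1 := by nlinarith [norm_nonneg (f 1)]
      nlinarith
    apply Complex.ext <;> simp [*]
  exact ⟨f, posF_of_norm hf e3, e3, e2⟩

theorem exists_state [Nontrivial A] {a : A} (ha : IsSelfAdjoint a) :
    ∃ f : A →L[ℂ] ℂ, PosF f ∧ f 1 = 1 ∧ ((f a).re = ‖a‖ ∨ (f a).re = -‖a‖) := by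
  rcases CStarAlgebra.norm_or_neg_norm_mem_spectrum ha with h | h
  · obtain ⟨f, h1, h2, h3⟩ := exists_state_aux h
    exact ⟨f, h1, h2, Or.inl h3⟩
  · obtain ⟨f, h1, h2, h3⟩ := exists_state_aux (a := -a) (by
      rw [norm_neg, ← spectrum.neg_eq]; simpa using h)
    refine ⟨f, h1, h2, Or.inr ?_⟩
    simp at h3; linarith

/-- positive functionals of norm at most one, weak* -/
def P1 (A : Type*) [CStarAlgebra A] : Set (WeakDual ℂ A) :=
  {φ | (∀ a : A, 0 ≤ φ (star a * a)) ∧ (φ 1).re ≤ 1}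

theorem P1_convex : Convex ℝ (P1 A) := by
  intro x hx y hy s t hs ht hst
  have e : ∀ a, (s • x + t • y : WeakDual ℂ A) a = s * x a + t * y a := fun a => by
    change s • x a + t • y a = _
    simp
  refine ⟨fun a => ?_, ?_⟩
  · rw [e]
    have h1 := hx.1 a
    have h2 := hy.1 a
    have hs' : (0:ℂ) ≤ s := by exact_mod_cast hs
    have ht' : (0:ℂ) ≤ t := by exact_mod_cast ht
    positivity
  · rw [e]
    simp
    nlinarith [hx.2, hy.2]

theorem P1_compact : IsCompact (P1 A) := by
  apply WeakDual.isCompact_of_bounded_of_closed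
  · refine (WeakDual.isBounded_closedBall (0 : StrongDual ℂ A) 2).subset ?_
    intro φ hφ
    simp only [Set.mem_preimage, Metric.mem_closedBall, dist_zero_right]
    refine ContinuousLinearMap.opNorm_le_bound _ (by norm_num) fun a => ?_
    have := PosF.bound (φ := WeakDual.toStrongDual φ) hφ.1 a
    have h2 : (WeakDual.toStrongDual φ 1).re ≤ 1 := hφ.2
    refine this.trans ?_
    nlinarith [norm_nonneg a]
  · have : P1 A = (⋂ a : A, {φ | 0 ≤ φ (star a * a)}) ∩ {φ | (φ 1).re ≤ 1} := by
      ext; simp [P1]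
    rw [this]
    refine IsClosed.inter (isClosed_iInter fun a => ?_) ?_
    · exact isClosed_le continuous_const (WeakDual.eval_continuous _)
    · exact isClosed_le (Complex.continuous_re.comp (WeakDual.eval_continuous _)) continuous_const

open scoped Pointwise in
theorem jordan [Nontrivial A] (φ : A →L[ℂ] ℂ) (hφ : ∀ a, φ (star a) = star (φ a))
    (hn : ‖φ‖ ≤ 1) : ∃ p q : A →L[ℂ] ℂ, PosF p ∧ PosF q ∧ φ = p - q := by
  have hK : IsCompact (P1 A - P1 A) := by
    rw [sub_eq_add_neg]
    exact P1_compact.add P1_compact.neg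
  have st : IsScalarTower ℝ ℂ (WeakDual ℂ A) :=
    ⟨fun r c ψ => DFunLike.ext _ _ fun a => smul_assoc r c (ψ a)⟩
  have lc : LocallyConvexSpace ℝ (WeakDual ℂ A) :=
    (WeakDual.withSeminorms (𝕜 := ℂ) (E := A)).toLocallyConvexSpace
  have hKc : Convex ℝ (P1 A - P1 A) := P1_convex.sub P1_convex
  by_cases hmem : StrongDual.toWeakDual φ ∈ P1 A - P1 A
  · obtain ⟨p, hp, q, hq, e⟩ := hmem
    refine ⟨WeakDual.toStrongDual p, WeakDual.toStrongDual q, hp.1, hq.1, ?_⟩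
    exact e.symm
  exfalso
  obtain ⟨F, u, h1, h2⟩ := @RCLike.geometric_hahn_banach_closed_point ℂ (WeakDual ℂ A)
    _ _ _ _ _ _ _ _ _ _ lc hKc hK.isClosed hmem
  obtain ⟨x, hx⟩ := LinearMap.dualEmbedding_surjective (topDualPairing ℂ A) F
  have hF : ∀ ψ : WeakDual ℂ A, F ψ = ψ x := fun ψ => by rw [← hx]; rfl
  simp only [hF] at h1 h2
  have z : (0 : WeakDual ℂ A) ∈ P1 A := by
    refine ⟨fun a => ?_, ?_⟩
    · change (0:ℂ) ≤ 0
      exact le_rfl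
    · change (0:ℂ).re ≤ 1
      simp
  have hre : ∀ ψ : A →L[ℂ] ℂ, (∀ a, ψ (star a) = star (ψ a)) →
      (ψ (realPart x : A)).re = (ψ x).re := by
    intro ψ hψ
    rw [realPart_apply_coe, ← Complex.coe_smul, map_smul, map_add, hψ]
    simp
    ring
  obtain ⟨f, hf, hf1, hfa⟩ := exists_state (realPart x).2
  have hfP : StrongDual.toWeakDual f ∈ P1 A := ⟨hf, by
    change (f 1).re ≤ 1
    rw [hf1]; simp⟩
  have k1 := h1 _ (Set.sub_mem_sub hfP z)
  have k2 := h1 _ (Set.sub_mem_sub z hfP)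
  have k1' : (f x).re < u := by simpa using k1
  have k2' : -(f x).re < u := by
    have e : ((0 : WeakDual ℂ A) - StrongDual.toWeakDual f : WeakDual ℂ A) x = 0 - f x := rfl
    rw [e] at k2
    simpa using k2
  have k3 : u < (φ x).re := h2
  rw [← hre _ hf.map_star] at k1' k2'
  rw [← hre _ hφ] at k3
  have k4 : (φ (realPart x : A)).re ≤ ‖(realPart x : A)‖ := by
    refine (Complex.re_le_norm _).trans ?_
    simpa using φ.le_of_opNorm_le hn (realPart x : A)
  have : ‖(realPart x : A)‖ < u ∨ False := by
    left
    rcases hfa with h | h <;> linarith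
  rcases this with h | h
  · linarith
  · exact h

theorem exists_herm (B : StarSubalgebra ℂ A) (hB : IsClosed (B : Set A)) {a : A} (ha : a ∉ B) :
    ∃ φ : A →L[ℂ] ℂ, (∀ x, φ (star x) = star (φ x)) ∧ (∀ b ∈ B, φ b = 0) ∧ φ a ≠ 0 := by
  have hc : Convex ℝ (B : Set A) := by
    intro x hx y hy s t _ _ _
    rw [← Complex.coe_smul, ← Complex.coe_smul]
    exact B.add_mem (B.smul_mem hx _) (B.smul_mem hy _)
  obtain ⟨g, u, h1, h2⟩ := RCLike.geometric_hahn_banach_closed_point (𝕜 := ℂ) hc hB ha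
  have hu : 0 < u := by simpa using h1 0 B.zero_mem
  have g0 : ∀ b ∈ B, g b = 0 := by
    intro b hb
    by_contra hne
    have := h1 _ (B.smul_mem hb ((u : ℂ) / g b))
    rw [map_smul, smul_eq_mul, div_mul_cancel₀ _ hne] at this
    simp at this
  have ga : g a ≠ 0 := by
    intro h; rw [h] at h2; simp at h2; linarith
  let gs : A →L[ℂ] ℂ :=
    { toFun := fun x => star (g (star x))
      map_add' := fun x y => by simp
      map_smul' := fun c x => by simp
      cont := by fun_prop }
  have gse : ∀ x, gs x = star (g (star x)) := fun _ => rfl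
  by_cases h : g a + gs a = 0
  · refine ⟨Complex.I • (g - gs), fun x => ?_, fun b hb => ?_, ?_⟩
    · simp [gse]; ring
    · simp [gse, g0 b hb, g0 _ (star_mem hb)]
    · have : gs a = - g a := by linear_combination h
      simp [this, ga, ← two_mul]
  · refine ⟨g + gs, fun x => ?_, fun b hb => ?_, ?_⟩
    · simp [gse, add_comm]
    · simp [gse, g0 b hb, g0 _ (star_mem hb)]
    · simpa using h

theorem exists_states (B : StarSubalgebra ℂ A) (hB : IsClosed (B : Set A)) {a : A} (ha : a ∉ B) :
    ∃ p q : A →L[ℂ] ℂ, PosF p ∧ PosF q ∧ p 1 = 1 ∧ q 1 = 1 ∧ (∀ b ∈ B, p b = q b) ∧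
      p a ≠ q a := by
  have nt : Nontrivial A := ⟨a, 0, fun h => ha (h ▸ B.zero_mem)⟩
  obtain ⟨φ, h1, h2, h3⟩ := exists_herm B hB ha
  have hφ : φ ≠ 0 := fun h => h3 (by simp [h])
  have hφn : 0 < ‖φ‖ := norm_pos_iff.2 hφ
  obtain ⟨p, q, hp, hq, e⟩ := jordan ((‖φ‖⁻¹ : ℝ) • φ) (fun x => by
    simp [h1]) (by rw [norm_smul, norm_inv, norm_norm, inv_mul_cancel₀ hφn.ne'])
  have e' : ∀ x, ((‖φ‖⁻¹ : ℝ) : ℂ) * φ x = p x - q x := fun x => by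
    have := congrArg (fun f : A →L[ℂ] ℂ => f x) e
    simpa using this
  have hpq : ∀ b ∈ B, p b = q b := fun b hb => by
    have := e' b
    rw [h2 b hb, mul_zero] at this
    exact (sub_eq_zero.1 this.symm)
  have hne : p a ≠ q a := by
    intro h
    have := e' a
    rw [h, sub_self] at this
    simp [h3, hφ] at this
  have p1 : 0 ≤ p 1 := by simpa using hp 1
  have pq1 := hpq 1 B.one_mem
  have p10 : p 1 ≠ 0 := by
    intro h0
    have a1 := hp.bound a
    have a2 := hq.bound a
    rw [← pq1] at a2
    rw [h0] at a1 a2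
    simp at a1 a2
    exact hne (a1.trans a2.symm)
  have ipos : 0 ≤ (p 1)⁻¹ := inv_nonneg.2 p1
  refine ⟨(p 1)⁻¹ • p, (p 1)⁻¹ • q, fun x => ?_, fun x => ?_, ?_, ?_, fun b hb => ?_, ?_⟩
  · exact mul_nonneg ipos (hp x)
  · exact mul_nonneg ipos (hq x)
  · simp [p10]
  · simp [← pq1, p10]
  · simp [hpq b hb]
  · simp [p10, hne]

theorem state_eval_continuous {Y : Type*} [TopologicalSpace Y] (f : C(Y, A)) :
    Continuous fun p : Y × StateSpace A => p.2.1 (f p.1) := by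
  rw [continuous_iff_continuousAt]
  rintro ⟨y, τ⟩
  have hb : ∀ (ρ : StateSpace A) (a : A), ‖ρ.1 a‖ ≤ 2 * ‖a‖ := by
    intro ρ a
    have := PosF.bound (φ := WeakDual.toStrongDual ρ.1) ρ.2.2 a
    have h1 : (WeakDual.toStrongDual ρ.1) 1 = 1 := ρ.2.1
    rw [h1] at this
    simpa using this
  have t1 : Tendsto (fun p : Y × StateSpace A => p.2.1 (f p.1 - f y)) (𝓝 (y, τ)) (𝓝 0) := by
    refine squeeze_zero_norm (fun p => hb p.2 _) ?_
    have : Continuous fun p : Y × StateSpace A => 2 * ‖f p.1 - f y‖ := by fun_prop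
    have := this.tendsto (y, τ)
    simpa using this
  have t2 : Tendsto (fun p : Y × StateSpace A => p.2.1 (f y)) (𝓝 (y, τ)) (𝓝 (τ.1 (f y))) := by
    have : Continuous fun p : Y × StateSpace A => p.2.1 (f y) :=
      (WeakDual.eval_continuous (f y)).comp (continuous_subtype_val.comp continuous_snd)
    exact this.tendsto (y, τ)
  have := t1.add t2
  simpa [ContinuousAt] using this

theorem mem_of_pointwise {Y : Type*} [TopologicalSpace Y] [CompactSpace Y] [T2Space Y]
    (Q : StarSubalgebra ℂ C(Y, A)) (hQclosed : IsClosed (Q : Set C(Y, A)))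
    (hQY : ∀ g : C(Y, ℂ), embedScalar A g ∈ Q) (f : C(Y, A))
    (hf : ∀ y, ∀ ε > 0, ∃ q ∈ Q, ‖q y - f y‖ < ε) : f ∈ Q := by
  have : f ∈ closure (Q : Set C(Y, A)) := by
    rw [Metric.mem_closure_iff]
    intro ε hε
    choose q hq hqf using fun y => hf y (ε / 2) (by positivity)
    let U : Y → Set Y := fun y => {z | ‖q y z - f z‖ < ε / 2}
    have hUo : ∀ y, IsOpen (U y) := fun y =>
      isOpen_lt (by fun_prop) continuous_const
    obtain ⟨t, ht⟩ := isCompact_univ.elim_finite_subcover U hUo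
      (fun y _ => Set.mem_iUnion.2 ⟨y, hqf y⟩)
    obtain ⟨ρ, hρ⟩ := PartitionOfUnity.exists_isSubordinate (X := Y) (s := Set.univ) isClosed_univ
      (fun i : t => U i) (fun i => hUo i) (fun y hy => by
        have := ht hy
        simp only [Set.mem_iUnion] at this ⊢
        obtain ⟨i, hi, h⟩ := this
        exact ⟨⟨i, hi⟩, h⟩)
    let g : t → C(Y, ℂ) := fun i => ⟨fun y => ((ρ i y : ℝ) : ℂ), by fun_prop⟩
    refine ⟨∑ i : t, embedScalar A (g i) * q i, ?_, ?_⟩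
    · exact sum_mem fun i _ => mul_mem (hQY _) (hq _)
    · rw [dist_eq_norm]
      refine lt_of_le_of_lt ?_ (half_lt_self hε)
      rw [ContinuousMap.norm_le _ (by positivity)]
      intro y
      have hsum : ∑ i : t, ρ i y = 1 := by
        rw [← finsum_eq_sum_of_fintype]
        exact ρ.sum_eq_one (Set.mem_univ y)
      have e : (f - ∑ i : t, embedScalar A (g i) * q i) y
          = ∑ i : t, ρ i y • (f y - q i y) := by
        simp only [smul_sub, Finset.sum_sub_distrib]
        rw [← Finset.sum_smul, hsum, one_smul]
        simp [ContinuousMap.sum_apply, embedScalar, g]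
      rw [e]
      calc ‖∑ i : t, ρ i y • (f y - q i y)‖ ≤ ∑ i : t, ρ i y * (ε / 2) := by
            refine (norm_sum_le _ _).trans (Finset.sum_le_sum fun i _ => ?_)
            rw [norm_smul, Real.norm_of_nonneg (ρ.nonneg i y)]
            by_cases h : ρ i y = 0
            · simp [h]
            · have : y ∈ U i := hρ i (subset_tsupport _ h)
              gcongr
              · exact ρ.nonneg i y
              · rw [norm_sub_rev]; exact le_of_lt this
        _ = ε / 2 := by rw [← Finset.sum_mul, hsum, one_mul]
  rwa [hQclosed.closure_eq] at this

/-- evaluation at a point as a star algebra homomorphism -/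
def evalHom (Y A : Type*) [TopologicalSpace Y] [CStarAlgebra A] (y : Y) :
    C(Y, A) →⋆ₐ[ℂ] A where
  toFun f := f y
  map_one' := rfl
  map_mul' _ _ := rfl
  map_zero' := rfl
  map_add' _ _ := rfl
  commutes' _ := rfl
  map_star' _ := rfl

end Helpers

/- STATEMENT 19: Suppose every intermediate `G`-factor `Y × S(A) → Z → Y` is a product
`Y × K` (expressed via closed `G`-invariant equivalence relations on `Y × S(A)`
refining the first projection).  Then every `G`-invariant closed *-subalgebra
`C(Y) ⊆ Q ⊆ C(Y,A)` splits as a tensor product `C(Y) ⊗min 𝓑`. -/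
theorem splitting_of_intermediate_factor_property_on_states
    {G Y A : Type*} [Group G] [TopologicalSpace Y] [CompactSpace Y] [T2Space Y]
    [MulAction G Y] (hc : ∀ s : G, Continuous fun y : Y => s • y)
    [CStarAlgebra A] (σ : G →* (A →⋆ₐ[ℂ] A))
    (Q : StarSubalgebra ℂ C(Y, A)) (hQclosed : IsClosed (Q : Set C(Y, A)))
    (hQinv : ∀ s : G, ∀ f ∈ Q, diagAct hc σ s f ∈ Q)
    (hQY : ∀ g : C(Y, ℂ), embedScalar A g ∈ Q)
    (hfactor : ∀ r : (Y × StateSpace A) → (Y × StateSpace A) → Prop, Equivalence r →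
      IsClosed {p : (Y × StateSpace A) × (Y × StateSpace A) | r p.1 p.2} →
      (∀ (s : G) (p q : Y × StateSpace A), r p q →
        r (s • p.1, stateAct σ s p.2) (s • q.1, stateAct σ s q.2)) →
      (∀ p q : Y × StateSpace A, r p q → p.1 = q.1) →
      ∃ re : StateSpace A → StateSpace A → Prop, Equivalence re ∧
        IsClosed {p : StateSpace A × StateSpace A | re p.1 p.2} ∧
        (∀ (s : G) (τ τ' : StateSpace A), re τ τ' → re (stateAct σ s τ) (stateAct σ s τ')) ∧
        ∀ p q : Y × StateSpace A, r p q ↔ (p.1 = q.1 ∧ re p.2 q.2)) :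
    ∃ 𝓑 : StarSubalgebra ℂ A, IsClosed (𝓑 : Set A) ∧
      (∀ s : G, ∀ b ∈ 𝓑, σ s b ∈ 𝓑) ∧
      (Q : Set C(Y, A)) = {f : C(Y, A) | ∀ y : Y, f y ∈ 𝓑} := by
  
  rcases isEmpty_or_nonempty Y with hY | ⟨⟨y0⟩⟩
  · refine ⟨⊤, isClosed_univ, fun _ _ _ => trivial, ?_⟩
    ext f
    have : f = 0 := by ext y; exact hY.elim y
    simp [this]
  let r : (Y × StateSpace A) → (Y × StateSpace A) → Prop := fun p q =>
    p.1 = q.1 ∧ ∀ f ∈ Q, p.2.1 (f p.1) = q.2.1 (f q.1)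
  obtain ⟨re, -, -, -, hre⟩ := hfactor r
    ⟨fun _ => ⟨rfl, fun _ _ => rfl⟩, fun h => ⟨h.1.symm, fun f hf => (h.2 f hf).symm⟩,
      fun h h' => ⟨h.1.trans h'.1, fun f hf => (h.2 f hf).trans (h'.2 f hf)⟩⟩
    (by
      have : {p : (Y × StateSpace A) × (Y × StateSpace A) | r p.1 p.2} =
          {p | p.1.1 = p.2.1} ∩ ⋂ f ∈ Q, {p | p.1.2.1 (f p.1.1) = p.2.2.1 (f p.2.1)} := by
        ext p; simp [r]
      rw [this]
      refine (isClosed_eq (by fun_prop) (by fun_prop)).inter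
        (isClosed_biInter fun f _ => isClosed_eq ?_ ?_)
      · exact (state_eval_continuous f).comp continuous_fst
      · exact (state_eval_continuous f).comp continuous_snd)
    (by
      rintro s ⟨y, τ⟩ ⟨y', τ'⟩ ⟨h1, h2⟩
      refine ⟨congrArg (s • ·) h1, fun f hf => ?_⟩
      have := h2 _ (hQinv s⁻¹ f hf)
      have e : ∀ z, diagAct hc σ s⁻¹ f z = σ s⁻¹ (f (s • z)) := fun z => by simp [diagAct]
      rw [e, e] at this
      exact this)
    (fun _ _ h => h.1)
  have indep : ∀ (y y' : Y) (τ τ' : StateSpace A), (∀ f ∈ Q, τ.1 (f y) = τ'.1 (f y)) →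
      ∀ f ∈ Q, τ.1 (f y') = τ'.1 (f y') := by
    intro y y' τ τ' h
    have h1 : r (y, τ) (y, τ') := ⟨rfl, h⟩
    have h2 := ((hre _ _).1 h1).2
    have h3 : r (y', τ) (y', τ') := (hre _ _).2 ⟨rfl, h2⟩
    exact h3.2
  let E : Y → StarSubalgebra ℂ A := fun y =>
    (Q.map (evalHom Y A y)).topologicalClosure
  have hEQ : ∀ y, ∀ f ∈ Q, f y ∈ E y := fun y f hf =>
    StarSubalgebra.le_topologicalClosure _ ⟨f, hf, rfl⟩
  have hEc : ∀ y, IsClosed (E y : Set A) := fun y =>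
    StarSubalgebra.isClosed_topologicalClosure _
  have hEmin : ∀ y (S : Set A), IsClosed S → (∀ f ∈ Q, f y ∈ S) → ∀ a ∈ E y, a ∈ S := by
    intro y S hS h a ha
    have : a ∈ closure ((Q.map (evalHom Y A y) : StarSubalgebra ℂ A) : Set A) := ha
    refine closure_minimal ?_ hS this
    rintro _ ⟨f, hf, rfl⟩
    exact h f hf
  have hsub : ∀ y y' a, a ∈ E y → a ∈ E y' := by
    intro y y' a ha
    by_contra hna
    obtain ⟨p, q, hp, hq, hp1, hq1, hpq, hne⟩ := exists_states (E y') (hEc y') hna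
    have h := indep y' y ⟨StrongDual.toWeakDual p, hp1, hp⟩ ⟨StrongDual.toWeakDual q, hq1, hq⟩
      (fun f hf => hpq _ (hEQ y' f hf))
    exact hne (hEmin y {x | p x = q x} (isClosed_eq p.continuous q.continuous) h a ha)
  refine ⟨E y0, hEc y0, fun s b hb => ?_, ?_⟩
  · refine hEmin y0 {x | σ s x ∈ E y0}
      ((hEc y0).preimage (MonoidHom.starAlgHom_continuous σ s)) (fun f hf => ?_) b hb
    have := hEQ (s • y0) _ (hQinv s f hf)
    have e : diagAct hc σ s f (s • y0) = σ s (f y0) := by simp [diagAct]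
    rw [e] at this
    exact hsub _ _ _ this
  · ext f
    refine ⟨fun hf y => hsub y y0 _ (hEQ y f hf), fun hf => ?_⟩
    refine mem_of_pointwise Q hQclosed hQY f fun y ε hε => ?_
    have h1 : f y ∈ closure ((Q.map (evalHom Y A y) : StarSubalgebra ℂ A) : Set A) :=
      hsub y0 y _ (hf y)
    rw [Metric.mem_closure_iff] at h1
    obtain ⟨_, ⟨q, hq, rfl⟩, hd⟩ := h1 ε hε
    refine ⟨q, hq, ?_⟩
    rw [dist_comm, dist_eq_norm] at hd
    exact hd
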